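/- Geometric commutation for the number operator and the creation operator: the QCPB satisfies [N̂, a†] = a† + a†∘N̂^(cg) + N̂∘b, where N̂ = a†∘a, N̂^(cg) = −(i/ω)·ŵ^(cl), and b is the multiplication operator by √(ℏ/2mω)·u; the identity holds applied to every smooth f : ℝ → ℂ. -/

import Mathlib

noncomputable section
open Complex

/-- Operators acting on functions `ℝ → ℂ`. -/
abbrev Op : Type := (ℝ → ℂ) → (ℝ → ℂ)

/-- Multiplication operator by a real-valued function. -/
def mulOp (g : ℝ → ℝ) : Op := fun f x => (g x : ℂ) * f x

/-- Quantum Poisson bracket `[A,B]_QPB = A∘B − B∘A`. -/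
def QPB (A B : Op) : Op := fun f => A (B f) - B (A f)

/-- Quantum covariant Poisson bracket
`[A,B] = [A,B]_QPB + A∘[s,B]_QPB − B∘[s,A]_QPB`. -/
def QCPB (s : ℝ → ℝ) (A B : Op) : Op :=
  fun f => QPB A B f + A (QPB (mulOp s) B f) - B (QPB (mulOp s) A f)

/-- Position (multiplication by `x`). -/
def xhat : Op := fun f x => (x : ℂ) * f x

/-- Classical momentum operator `p̂⁽ᶜˡ⁾ f = −iℏ f'`. -/
def pcl (ℏ : ℝ) : Op := fun f x => -Complex.I * (ℏ : ℂ) * deriv f x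

/-- Classical harmonic-oscillator Hamiltonian. -/
def Hcl (ℏ m ω : ℝ) : Op := fun f x =>
  -((ℏ : ℂ) ^ 2 / (2 * (m : ℂ))) * deriv (deriv f) x
    + ((m : ℂ) * (ω : ℂ) ^ 2 / 2) * (x : ℂ) ^ 2 * f x

/-- Geomentum operator `p̂⁽ʳⁱ⁾ f = −iℏ (f' + u f)` with `u = s'`. -/
def pri (ℏ : ℝ) (s : ℝ → ℝ) : Op := fun f x =>
  -Complex.I * (ℏ : ℂ) * (deriv f x + ((deriv s x : ℝ) : ℂ) * f x)

/-- Ri-operator Hamiltonian `Ĥ⁽ʳⁱ⁾ = (1/2m) p̂⁽ʳⁱ⁾∘p̂⁽ʳⁱ⁾ + (mω²/2)x²`. -/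
def Hri (ℏ m ω : ℝ) (s : ℝ → ℝ) : Op := fun f x =>
  (1 / (2 * (m : ℂ))) * pri ℏ s (pri ℏ s f) x
    + ((m : ℂ) * (ω : ℂ) ^ 2 / 2) * (x : ℂ) ^ 2 * f x

/-- G-dynamics operator `ŵ⁽ᶜˡ⁾ f = −(iℏ/2m)(2u f' + u' f)`. -/
def wcl (ℏ m : ℝ) (s : ℝ → ℝ) : Op := fun f x =>
  -(Complex.I * (ℏ : ℂ) / (2 * (m : ℂ))) *
    (2 * ((deriv s x : ℝ) : ℂ) * deriv f x + ((deriv (deriv s) x : ℝ) : ℂ) * f x)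

/-- Ri G-dynamics operator `ŵ⁽ʳⁱ⁾ f = −(iℏ/2m)(2u f' + u' f + 2u² f)`. -/
def wri (ℏ m : ℝ) (s : ℝ → ℝ) : Op := fun f x =>
  -(Complex.I * (ℏ : ℂ) / (2 * (m : ℂ))) *
    (2 * ((deriv s x : ℝ) : ℂ) * deriv f x + ((deriv (deriv s) x : ℝ) : ℂ) * f x
      + 2 * ((deriv s x : ℝ) : ℂ) ^ 2 * f x)

/-- Annihilation operator. -/
def aOp (ℏ m ω : ℝ) : Op := fun f x =>
  (Real.sqrt (m * ω / (2 * ℏ)) : ℂ) *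
    ((x : ℂ) * f x + ((ℏ : ℂ) / ((m : ℂ) * (ω : ℂ))) * deriv f x)

/-- Creation operator. -/
def adOp (ℏ m ω : ℝ) : Op := fun f x =>
  (Real.sqrt (m * ω / (2 * ℏ)) : ℂ) *
    ((x : ℂ) * f x - ((ℏ : ℂ) / ((m : ℂ) * (ω : ℂ))) * deriv f x)

/-- `b`: multiplication by `√(ℏ/2mω)·u`. -/
def bOp (ℏ m ω : ℝ) (s : ℝ → ℝ) : Op :=
  mulOp (fun x => Real.sqrt (ℏ / (2 * m * ω)) * deriv s x)

/-- Number operator `N̂ = a†∘a`. -/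
def NOp (ℏ m ω : ℝ) : Op := fun f => adOp ℏ m ω (aOp ℏ m ω f)

/-- `N̂⁽ᶜᵍ⁾ = −(i/ω)·ŵ⁽ᶜˡ⁾`. -/
def Ncg (ℏ m ω : ℝ) (s : ℝ → ℝ) : Op := fun f x =>
  -(Complex.I / (ω : ℂ)) * wcl ℏ m s f x

/-- Geometric annihilation operator `a⁽ˢ⁾ = a + b`. -/
def asOp (ℏ m ω : ℝ) (s : ℝ → ℝ) : Op := fun f x =>
  aOp ℏ m ω f x + bOp ℏ m ω s f x

/-- Geometric creation operator `a⁽ˢ⁾† = a† − b`. -/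
def adsOp (ℏ m ω : ℝ) (s : ℝ → ℝ) : Op := fun f x =>
  adOp ℏ m ω f x - bOp ℏ m ω s f x

theorem ContDiff.complex_ofReal_comp {n : WithTop ℕ∞} {g : ℝ → ℝ} (hg : ContDiff ℝ n g) :
    ContDiff ℝ n (fun x => (g x : ℂ)) :=
  Complex.ofRealCLM.contDiff.comp hg

theorem ContDiff.deriv_of_smooth {F : Type*} [NormedAddCommGroup F] [NormedSpace ℝ F]
    {f : ℝ → F} (hf : ContDiff ℝ (⊤ : ℕ∞) f) : ContDiff ℝ (⊤ : ℕ∞) (deriv f) :=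
  (contDiff_infty_iff_deriv.1 hf).2

theorem contDiff_mulOp {g : ℝ → ℝ} {f : ℝ → ℂ} (hg : ContDiff ℝ (⊤ : ℕ∞) g)
    (hf : ContDiff ℝ (⊤ : ℕ∞) f) : ContDiff ℝ (⊤ : ℕ∞) (mulOp g f) :=
  hg.complex_ofReal_comp.mul hf

theorem contDiff_aOp (ℏ m ω : ℝ) {f : ℝ → ℂ} (hf : ContDiff ℝ (⊤ : ℕ∞) f) :
    ContDiff ℝ (⊤ : ℕ∞) (aOp ℏ m ω f) :=
  contDiff_const.mul ((contDiff_id.complex_ofReal_comp.mul hf).add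
    (contDiff_const.mul hf.deriv_of_smooth))

theorem contDiff_adOp (ℏ m ω : ℝ) {f : ℝ → ℂ} (hf : ContDiff ℝ (⊤ : ℕ∞) f) :
    ContDiff ℝ (⊤ : ℕ∞) (adOp ℏ m ω f) :=
  contDiff_const.mul ((contDiff_id.complex_ofReal_comp.mul hf).sub
    (contDiff_const.mul hf.deriv_of_smooth))

theorem contDiff_bOp (ℏ m ω : ℝ) {s : ℝ → ℝ} {f : ℝ → ℂ} (hs : ContDiff ℝ (⊤ : ℕ∞) s)
    (hf : ContDiff ℝ (⊤ : ℕ∞) f) : ContDiff ℝ (⊤ : ℕ∞) (bOp ℏ m ω s f) :=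
  contDiff_mulOp (contDiff_const.mul hs.deriv_of_smooth) hf

theorem ContDiff.differentiable_of_smooth {F : Type*} [NormedAddCommGroup F] [NormedSpace ℝ F]
    {f : ℝ → F} (hf : ContDiff ℝ (⊤ : ℕ∞) f) : Differentiable ℝ f :=
  (contDiff_infty_iff_deriv.1 hf).1

theorem deriv_mulOp {g : ℝ → ℝ} {f : ℝ → ℂ} (hg : Differentiable ℝ g)
    (hf : Differentiable ℝ f) (x : ℝ) :
    deriv (mulOp g f) x = ((deriv g x : ℝ) : ℂ) * f x + (g x : ℂ) * deriv f x :=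
  ((hg x).hasDerivAt.ofReal_comp.mul (hf x).hasDerivAt).deriv

theorem adOp_add (ℏ m ω : ℝ) {f g : ℝ → ℂ} (hf : Differentiable ℝ f)
    (hg : Differentiable ℝ g) :
    adOp ℏ m ω (f + g) = adOp ℏ m ω f + adOp ℏ m ω g := by
  funext x
  simp only [adOp, Pi.add_apply, deriv_add (hf x) (hg x)]
  ring

theorem adOp_neg (ℏ m ω : ℝ) (f : ℝ → ℂ) : adOp ℏ m ω (-f) = -adOp ℏ m ω f := by
  funext x
  simp only [adOp, Pi.neg_apply, deriv.neg]
  ring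

theorem sqrt_mul_div_eq_sqrt {ℏ m ω : ℝ} (hℏ : 0 < ℏ) (hm : 0 < m) (hω : 0 < ω) :
    Real.sqrt (m * ω / (2 * ℏ)) * (ℏ / (m * ω)) = Real.sqrt (ℏ / (2 * m * ω)) := by
  have h : ℏ / (2 * m * ω) = m * ω / (2 * ℏ) * (ℏ / (m * ω)) ^ 2 := by
    field_simp
  rw [h, Real.sqrt_mul (by positivity), Real.sqrt_sq (by positivity)]

theorem ofReal_sqrt_eq_sqrt_mul_div {ℏ m ω : ℝ} (hℏ : 0 < ℏ) (hm : 0 < m) (hω : 0 < ω) :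
    (Real.sqrt (ℏ / (2 * m * ω)) : ℂ)
      = (Real.sqrt (m * ω / (2 * ℏ)) : ℂ) * ((ℏ : ℂ) / ((m : ℂ) * (ω : ℂ))) := by
  exact_mod_cast (sqrt_mul_div_eq_sqrt hℏ hm hω).symm

theorem sq_sqrt_mul_div {ℏ m ω : ℝ} (hℏ : 0 < ℏ) (hm : 0 < m) (hω : 0 < ω) :
    (Real.sqrt (m * ω / (2 * ℏ)) : ℂ) ^ 2 * ((ℏ : ℂ) / ((m : ℂ) * (ω : ℂ))) = 1 / 2 := by
  have h : Real.sqrt (m * ω / (2 * ℏ)) ^ 2 * (ℏ / (m * ω)) = 1 / 2 := by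
    rw [Real.sq_sqrt (by positivity)]
    field_simp
  simpa using congrArg Complex.ofReal h

section Commutators

variable {ℏ m ω : ℝ} {s : ℝ → ℝ} {f : ℝ → ℂ}

theorem adOp_mulOp (hℏ : 0 < ℏ) (hm : 0 < m) (hω : 0 < ω)
    (hs : Differentiable ℝ s) (hf : Differentiable ℝ f) :
    adOp ℏ m ω (mulOp s f) = mulOp s (adOp ℏ m ω f) - bOp ℏ m ω s f := by
  funext x
  simp only [adOp, bOp, deriv_mulOp hs hf, Pi.sub_apply]
  simp only [mulOp, adOp, Complex.ofReal_mul, ofReal_sqrt_eq_sqrt_mul_div hℏ hm hω]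
  ring

theorem aOp_mulOp (hℏ : 0 < ℏ) (hm : 0 < m) (hω : 0 < ω)
    (hs : Differentiable ℝ s) (hf : Differentiable ℝ f) :
    aOp ℏ m ω (mulOp s f) = mulOp s (aOp ℏ m ω f) + bOp ℏ m ω s f := by
  funext x
  simp only [aOp, bOp, deriv_mulOp hs hf, Pi.add_apply]
  simp only [mulOp, aOp, Complex.ofReal_mul, ofReal_sqrt_eq_sqrt_mul_div hℏ hm hω]
  ring

/-- The canonical commutation relation `[a, a†] = 1`. -/
theorem aOp_adOp (hℏ : 0 < ℏ) (hm : 0 < m) (hω : 0 < ω) (hf : ContDiff ℝ (⊤ : ℕ∞) f) :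
    aOp ℏ m ω (adOp ℏ m ω f) = adOp ℏ m ω (aOp ℏ m ω f) + f := by
  funext x
  have hx : HasDerivAt (fun y : ℝ => (y : ℂ)) 1 x := by
    simpa using (hasDerivAt_id x).ofReal_comp
  have h₀ := hx.mul (hf.differentiable_of_smooth x).hasDerivAt
  have h₁ := (hf.deriv_of_smooth.differentiable_of_smooth x).hasDerivAt.const_mul
    ((ℏ : ℂ) / ((m : ℂ) * (ω : ℂ)))
  have ha : deriv (aOp ℏ m ω f) x = _ := ((h₀.add h₁).const_mul _).deriv
  have had : deriv (adOp ℏ m ω f) x = _ := ((h₀.sub h₁).const_mul _).deriv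
  rw [Pi.add_apply, aOp, had, adOp, adOp, ha, aOp]
  linear_combination (2 * f x) * sq_sqrt_mul_div hℏ hm hω

/-- `a†∘b − b∘a = N̂⁽ᶜᵍ⁾`. -/
theorem adOp_bOp_sub_bOp_aOp (hℏ : 0 < ℏ) (hm : 0 < m) (hω : 0 < ω)
    (hs : ContDiff ℝ (⊤ : ℕ∞) s) (hf : Differentiable ℝ f) :
    adOp ℏ m ω (bOp ℏ m ω s f) - bOp ℏ m ω s (aOp ℏ m ω f) = Ncg ℏ m ω s f := by
  funext x
  have hu := hs.deriv_of_smooth.differentiable_of_smooth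
  have hm' : (m : ℂ) ≠ 0 := by exact_mod_cast hm.ne'
  have hω' : (ω : ℂ) ≠ 0 := by exact_mod_cast hω.ne'
  have hN : Ncg ℏ m ω s f x = -(1 / 2) * ((ℏ : ℂ) / ((m : ℂ) * (ω : ℂ))) *
      (2 * ((deriv s x : ℝ) : ℂ) * deriv f x + ((deriv (deriv s) x : ℝ) : ℂ) * f x) := by
    simp only [Ncg, wcl]
    field_simp
    linear_combination
      (ℏ : ℂ) * (2 * ((deriv s x : ℝ) : ℂ) * deriv f x + ((deriv (deriv s) x : ℝ) : ℂ) * f x) *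
        Complex.I_sq
  rw [hN, Pi.sub_apply]
  simp only [adOp, bOp, deriv_mulOp (hu.const_mul _) hf, deriv_const_mul _ (hu x)]
  simp only [mulOp, aOp, Complex.ofReal_mul, ofReal_sqrt_eq_sqrt_mul_div hℏ hm hω]
  linear_combination -((ℏ : ℂ) / ((m : ℂ) * (ω : ℂ))) *
    (2 * ((deriv s x : ℝ) : ℂ) * deriv f x + ((deriv (deriv s) x : ℝ) : ℂ) * f x) *
    sq_sqrt_mul_div hℏ hm hω

theorem QPB_mulOp_adOp (hℏ : 0 < ℏ) (hm : 0 < m) (hω : 0 < ω)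
    (hs : Differentiable ℝ s) (hf : Differentiable ℝ f) :
    QPB (mulOp s) (adOp ℏ m ω) f = bOp ℏ m ω s f := by
  rw [QPB, adOp_mulOp hℏ hm hω hs hf, sub_sub_cancel]

theorem QPB_mulOp_NOp (hℏ : 0 < ℏ) (hm : 0 < m) (hω : 0 < ω)
    (hs : ContDiff ℝ (⊤ : ℕ∞) s) (hf : ContDiff ℝ (⊤ : ℕ∞) f) :
    QPB (mulOp s) (NOp ℏ m ω) f = -Ncg ℏ m ω s f := by
  have ha := contDiff_aOp ℏ m ω hf
  rw [QPB, NOp, NOp,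
    aOp_mulOp hℏ hm hω hs.differentiable_of_smooth hf.differentiable_of_smooth,
    adOp_add ℏ m ω (contDiff_mulOp hs ha).differentiable_of_smooth
      (contDiff_bOp ℏ m ω hs hf).differentiable_of_smooth,
    adOp_mulOp hℏ hm hω hs.differentiable_of_smooth ha.differentiable_of_smooth,
    ← adOp_bOp_sub_bOp_aOp hℏ hm hω hs hf.differentiable_of_smooth]
  abel

theorem QPB_NOp_adOp (hℏ : 0 < ℏ) (hm : 0 < m) (hω : 0 < ω) (hf : ContDiff ℝ (⊤ : ℕ∞) f) :
    QPB (NOp ℏ m ω) (adOp ℏ m ω) f = adOp ℏ m ω f := by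
  rw [QPB, NOp, NOp, aOp_adOp hℏ hm hω hf,
    adOp_add ℏ m ω (contDiff_adOp ℏ m ω (contDiff_aOp ℏ m ω hf)).differentiable_of_smooth
      hf.differentiable_of_smooth, add_sub_cancel_left]

end Commutators

/-- Geometric commutation for the number and creation operators:
`[N̂, a†] = a† + a†∘N̂⁽ᶜᵍ⁾ + N̂∘b`. -/
theorem geometric_commutation_number_creation (ℏ m ω : ℝ)
    (hℏ : 0 < ℏ) (hm : 0 < m) (hω : 0 < ω)
    (s : ℝ → ℝ) (hs : ContDiff ℝ (⊤ : ℕ∞) s) :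
    ∀ f : ℝ → ℂ, ContDiff ℝ (⊤ : ℕ∞) f → ∀ x : ℝ,
      QCPB s (NOp ℏ m ω) (adOp ℏ m ω) f x
        = adOp ℏ m ω f x + adOp ℏ m ω (Ncg ℏ m ω s f) x
          + NOp ℏ m ω (bOp ℏ m ω s f) x := by
  intro f hf x
  rw [QCPB, QPB_NOp_adOp hℏ hm hω hf,
    QPB_mulOp_adOp hℏ hm hω hs.differentiable_of_smooth hf.differentiable_of_smooth,
    QPB_mulOp_NOp hℏ hm hω hs hf, adOp_neg]
  simp only [Pi.sub_apply, Pi.add_apply, Pi.neg_apply]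
  ring
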